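/- arXiv:2310.09544 — 3 statements merged into one kernel-verified Lean document; each statement's English description precedes it below -/
import Mathlib

section
/- For every p ∈ P̄ ∪ P², the function w : [0,1] → ℝ defined by w(q) = min(λ(p)·q + p₁ − c₁, p₂ − c₂) is the concave envelope (least concave majorant) of the expert's indirect utility v(·; p) on [0,1]: w is concave, w(q) ≥ v(q; p) for every q ∈ [0,1], and every concave function g : [0,1] → ℝ with g(q) ≥ v(q; p) for all q satisfies g(q) ≥ w(q) for all q. -/
open Set Filter
open scoped Classical

noncomputable section

/-- The cutoff posterior q̄(p). -/
def qBar (l₁ l₂ p₁ p₂ : ℝ) : ℝ :=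
  if l₂ - (l₂ - l₁) / l₁ * p₁ ≤ p₂ then (p₂ - l₁) / (l₂ - l₁) else (p₂ - p₁) / l₂

/-- The slope λ(p). -/
def lamP (c₁ c₂ l₁ l₂ p₁ p₂ : ℝ) : ℝ :=
  ((p₂ - c₂) - (p₁ - c₁)) / qBar l₁ l₂ p₁ p₂

/-- The credibility threshold χ̲(q₀; p). -/
def chiLo (l₁ l₂ p₁ p₂ q₀ : ℝ) : ℝ :=
  (qBar l₁ l₂ p₁ p₂ - q₀) / (qBar l₁ l₂ p₁ p₂ * (1 - q₀))

/-- The prior threshold q̲(χ; p). -/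
def qLo (l₁ l₂ p₁ p₂ χ : ℝ) : ℝ :=
  qBar l₁ l₂ p₁ p₂ * (1 - χ) / (1 - χ * qBar l₁ l₂ p₁ p₂)

/-- p = (p₁, p₂) is a price list. -/
def IsPriceList (c₁ c₂ l₁ l₂ p₁ p₂ : ℝ) : Prop :=
  c₁ ≤ p₁ ∧ p₁ ≤ l₁ ∧ c₂ ≤ p₂ ∧ p₂ ≤ l₂ ∧ p₁ ≤ p₂

/-- The expert's p-equilibrium value v*_χ(q₀; p) for p ∈ P̄ ∪ P². -/
def vStar (c₁ c₂ l₁ l₂ χ q₀ p₁ p₂ : ℝ) : ℝ :=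
  if qBar l₁ l₂ p₁ p₂ < q₀ then p₂ - c₂
  else if qLo l₁ l₂ p₁ p₂ χ ≤ q₀ then lamP c₁ c₂ l₁ l₂ p₁ p₂ * q₀ + (p₁ - c₁)
  else p₁ - c₁

/-- The credibility threshold χ*(q₀). -/
def chiStarF (c₁ c₂ l₁ l₂ q₀ : ℝ) : ℝ :=
  ((c₂ - c₁) - q₀ * (l₂ - l₁)) / ((1 - q₀) * (c₂ - c₁))

end
noncomputable section

/-- The client's expected payoff at posterior `q` from each of the three actions
`a₀` (no treatment), `a₁` (minor treatment), `a₂` (serious treatment). -/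
def uC (l₁ l₂ p₁ p₂ q : ℝ) : Fin 3 → ℝ
  | 0 => -(1 - q) * l₁ - q * l₂
  | 1 => -p₁ - q * l₂
  | 2 => -p₂

/-- The expert's payoff from each of the three actions. -/
def uE (c₁ c₂ p₁ p₂ : ℝ) : Fin 3 → ℝ
  | 0 => 0
  | 1 => p₁ - c₁
  | 2 => p₂ - c₂

/-- The expert's indirect utility v(q; p): the maximum of the expert's payoff over the
client's optimal actions at posterior q (ties broken in the expert's favor). -/
def indirectV (c₁ c₂ l₁ l₂ p₁ p₂ q : ℝ) : ℝ :=
  sSup {e | ∃ a : Fin 3,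
    (∀ a' : Fin 3, uC l₁ l₂ p₁ p₂ q a' ≤ uC l₁ l₂ p₁ p₂ q a) ∧ e = uE c₁ c₂ p₁ p₂ a}

end

/-- The payoff of any optimal action of the client is a lower bound of the indirect utility. -/
lemma uE_le_indirectV {c₁ c₂ l₁ l₂ p₁ p₂ q : ℝ} {a : Fin 3}
    (ha : ∀ a' : Fin 3, uC l₁ l₂ p₁ p₂ q a' ≤ uC l₁ l₂ p₁ p₂ q a) :
    uE c₁ c₂ p₁ p₂ a ≤ indirectV c₁ c₂ l₁ l₂ p₁ p₂ q := by
  refine le_csSup (((Set.finite_range (uE c₁ c₂ p₁ p₂)).subset ?_).bddAbove) ⟨a, ha, rfl⟩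
  rintro e ⟨b, -, rfl⟩
  exact ⟨b, rfl⟩

/-- The cutoff is positive when the minor treatment costs at most `l₁` and less than the
serious one. -/
lemma qBar_pos {l₁ l₂ p₁ p₂ : ℝ} (h₁ : 0 < l₁) (h₁₂ : l₁ < l₂) (hp₁ : p₁ ≤ l₁)
    (hlt : p₁ < p₂) : 0 < qBar l₁ l₂ p₁ p₂ := by
  unfold qBar
  split_ifs with h
  · refine div_pos ?_ (by linarith)
    rcases hp₁.lt_or_eq with hp | rfl
    · have : (l₂ - l₁) / l₁ * p₁ < l₂ - l₁ := by
        rw [div_mul_eq_mul_div, div_lt_iff₀ h₁]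
        exact mul_lt_mul_of_pos_left hp (by linarith)
      linarith
    · linarith
  · exact div_pos (by linarith) (by linarith)

/-- The cutoff is the larger of the two posteriors at which the client is indifferent between
the serious treatment and one of the other actions. -/
lemma qBar_le_iff {l₁ l₂ p₁ p₂ q : ℝ} (h₁ : 0 < l₁) (h₁₂ : l₁ < l₂) :
    qBar l₁ l₂ p₁ p₂ ≤ q ↔ p₂ ≤ l₁ + q * (l₂ - l₁) ∧ p₂ ≤ p₁ + q * l₂ := by
  have hd : 0 < l₂ - l₁ := by linarith
  have h₂ : 0 < l₂ := by linarith
  have hcond : l₂ - (l₂ - l₁) / l₁ * p₁ ≤ p₂ ↔ l₁ * l₂ - (l₂ - l₁) * p₁ ≤ p₂ * l₁ := by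
    rw [sub_le_comm, div_mul_eq_mul_div, le_div_iff₀ h₁]
    constructor <;> intro h <;> linarith
  unfold qBar
  split_ifs with h
  · rw [hcond] at h
    rw [div_le_iff₀ hd]
    refine ⟨fun hq => ⟨by linarith, ?_⟩, fun hq => by linarith [hq.1]⟩
    nlinarith [mul_le_mul_of_nonneg_right hq h₂.le]
  · rw [hcond, not_le] at h
    rw [div_le_iff₀ h₂]
    refine ⟨fun hq => ⟨?_, by linarith⟩, fun hq => by linarith [hq.2]⟩
    nlinarith [mul_le_mul_of_nonneg_right hq hd.le]

/-- The serious treatment is optimal for the client exactly at posteriors above the cutoff. -/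
lemma uC_two_optimal_iff {l₁ l₂ p₁ p₂ q : ℝ} (h₁ : 0 < l₁) (h₁₂ : l₁ < l₂) :
    (∀ a : Fin 3, uC l₁ l₂ p₁ p₂ q a ≤ uC l₁ l₂ p₁ p₂ q 2) ↔ qBar l₁ l₂ p₁ p₂ ≤ q := by
  rw [qBar_le_iff h₁ h₁₂, Fin.forall_fin_succ, Fin.forall_fin_two]
  change (-(1 - q) * l₁ - q * l₂ ≤ -p₂ ∧ -p₁ - q * l₂ ≤ -p₂ ∧ -p₂ ≤ -p₂) ↔ _
  constructor
  · rintro ⟨h, h', -⟩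
    constructor <;> linarith
  · rintro ⟨h, h'⟩
    refine ⟨?_, ?_, le_rfl⟩ <;> linarith

/-- The minor treatment is optimal for the client who is sure to have the minor problem. -/
lemma uC_one_optimal_zero {l₁ l₂ p₁ p₂ : ℝ} (hp₁ : p₁ ≤ l₁) (hle : p₁ ≤ p₂) (a : Fin 3) :
    uC l₁ l₂ p₁ p₂ 0 a ≤ uC l₁ l₂ p₁ p₂ 0 1 := by
  fin_cases a <;> simp [uC] <;> linarith

/-- for p ∈ P̄ ∪ P², the function q ↦ min(λ(p)·q + p₁ − c₁, p₂ − c₂) is the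
concave envelope (least concave majorant) of v(·; p) on [0,1]. -/
theorem concave_envelope_of_indirect_utility
    (c₁ c₂ l₁ l₂ : ℝ) (hc₁ : 0 ≤ c₁) (hc : c₁ < c₂) (h₁ : c₁ < l₁) (h₂ : c₂ < l₂)
    (hs : l₁ - c₁ < l₂ - c₂)
    (p₁ p₂ : ℝ) (hp : IsPriceList c₁ c₂ l₁ l₂ p₁ p₂)
    (hmem : p₁ - c₁ ≤ p₂ - c₂)
    (w : ℝ → ℝ)
    (hw : ∀ q, w q = min (lamP c₁ c₂ l₁ l₂ p₁ p₂ * q + (p₁ - c₁)) (p₂ - c₂)) :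
    ConcaveOn ℝ (Set.Icc (0:ℝ) 1) w ∧
    (∀ q ∈ Set.Icc (0:ℝ) 1, indirectV c₁ c₂ l₁ l₂ p₁ p₂ q ≤ w q) ∧
    (∀ g : ℝ → ℝ, ConcaveOn ℝ (Set.Icc (0:ℝ) 1) g →
      (∀ q ∈ Set.Icc (0:ℝ) 1, indirectV c₁ c₂ l₁ l₂ p₁ p₂ q ≤ g q) →
      ∀ q ∈ Set.Icc (0:ℝ) 1, w q ≤ g q) := by
  obtain ⟨hcp₁, hp₁, hcp₂, hp₂, -⟩ := hp
  have hl₁ : 0 < l₁ := by linarith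
  have hl : l₁ < l₂ := by linarith
  have hlt : p₁ < p₂ := by linarith
  obtain rfl : w = fun q => min (lamP c₁ c₂ l₁ l₂ p₁ p₂ * q + (p₁ - c₁)) (p₂ - c₂) := funext hw
  have hpos := qBar_pos hl₁ hl hp₁ hlt
  have hone : qBar l₁ l₂ p₁ p₂ ≤ 1 :=
    (qBar_le_iff hl₁ hl).2 ⟨by linarith, by linarith⟩
  have hlam : 0 ≤ lamP c₁ c₂ l₁ l₂ p₁ p₂ := div_nonneg (by linarith) hpos.le
  have hlam_mul : lamP c₁ c₂ l₁ l₂ p₁ p₂ * qBar l₁ l₂ p₁ p₂ = (p₂ - c₂) - (p₁ - c₁) :=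
    div_mul_cancel₀ _ hpos.ne'
  refine ⟨?_, ?_, ?_⟩
  · have haff : ConcaveOn ℝ (Set.Icc (0:ℝ) 1)
        (fun q => lamP c₁ c₂ l₁ l₂ p₁ p₂ * q + (p₁ - c₁)) :=
      ((concaveOn_id (convex_Icc 0 1)).smul hlam).add_const (p₁ - c₁)
    exact haff.inf (concaveOn_const (p₂ - c₂) (convex_Icc 0 1))
  · rintro q ⟨hq, -⟩
    have hmul := mul_nonneg hlam hq
    refine Real.sSup_le ?_ (le_min (by linarith) (by linarith))
    rintro e ⟨a, ha, rfl⟩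
    fin_cases a
    · exact le_min (show 0 ≤ _ by linarith) (show 0 ≤ _ by linarith)
    · exact le_min (show p₁ - c₁ ≤ _ by linarith) hmem
    · have hle := mul_le_mul_of_nonneg_left ((uC_two_optimal_iff hl₁ hl).1 ha) hlam
      exact le_min (show p₂ - c₂ ≤ _ by linarith) le_rfl
  · rintro g hg hvg q ⟨hq, hq1⟩
    have hhigh : ∀ r ∈ Set.Icc (0:ℝ) 1, qBar l₁ l₂ p₁ p₂ ≤ r → p₂ - c₂ ≤ g r := fun r hr hqr =>
      (uE_le_indirectV ((uC_two_optimal_iff hl₁ hl).2 hqr)).trans (hvg r hr)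
    have h0 : (0:ℝ) ∈ Set.Icc (0:ℝ) 1 := ⟨le_rfl, zero_le_one⟩
    have hlow : p₁ - c₁ ≤ g 0 :=
      (uE_le_indirectV (uC_one_optimal_zero hp₁ hlt.le)).trans (hvg 0 h0)
    rcases le_total (qBar l₁ l₂ p₁ p₂) q with hle | hle
    · exact (min_le_right _ _).trans (hhigh q ⟨hq, hq1⟩ hle)
    · refine (min_le_left _ _).trans ?_
      have hb := hhigh _ ⟨hpos.le, hone⟩ le_rfl
      set b := qBar l₁ l₂ p₁ p₂
      obtain ⟨t, rfl⟩ : ∃ t, q = t * b := ⟨q / b, (div_mul_cancel₀ _ hpos.ne').symm⟩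
      have ht0 : 0 ≤ t := nonneg_of_mul_nonneg_left hq hpos
      have ht1 : t ≤ 1 := by
        by_contra! h
        nlinarith
      have hconc := hg.2 h0 ⟨hpos.le, hone⟩ (sub_nonneg.2 ht1) ht0 (sub_add_cancel 1 t)
      simp only [smul_eq_mul, mul_zero, zero_add] at hconc
      calc lamP c₁ c₂ l₁ l₂ p₁ p₂ * (t * b) + (p₁ - c₁)
          = (1 - t) * (p₁ - c₁) + t * (p₂ - c₂) := by linear_combination t * hlam_mul
        _ ≤ (1 - t) * g 0 + t * g b := by
            have : 0 ≤ 1 - t := sub_nonneg.2 ht1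
            gcongr
        _ ≤ g (t * b) := hconc
end

section
/- (Sufficiency claim in the proof of Proposition 1.) Let p ∈ P², q₀ ∈ (0, q̄(p)) and χ ∈ (0,1) with χ ≥ χ̲(q₀; p). Then the triple (β, γ, k) = (0, q̄(p), 1 − q₀/q̄(p)) is feasible, and its objective value equals λ(p)·q₀ + (p₁ − c₁), which is strictly greater than p₁ − c₁. -/
open Set Filter
open scoped Classical

noncomputable section

/-- Feasibility of a triple (β, γ, k) in the Lipnowski–Ravid–Shishkin program. -/
def Feasible (q₀ χ β γ k : ℝ) : Prop :=
  β ∈ Set.Icc (0:ℝ) 1 ∧ γ ∈ Set.Icc (0:ℝ) 1 ∧ k ∈ Set.Icc (0:ℝ) 1 ∧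
  (1 - k) * γ + k * β = q₀ ∧ k * β ≤ χ * q₀ ∧ k * (1 - β) ≤ χ * (1 - q₀)

/-- The objective value (1 − k)·Q(γ) + k·C(γ, β) of a triple (β, γ, k). -/
def Obj (c₁ c₂ l₁ l₂ p₁ p₂ β γ k : ℝ) : ℝ :=
  (1 - k) * (if γ < qBar l₁ l₂ p₁ p₂ then p₁ - c₁ else p₂ - c₂) +
  k * (if γ < qBar l₁ l₂ p₁ p₂ then p₁ - c₁
       else min (lamP c₁ c₂ l₁ l₂ p₁ p₂ * β + (p₁ - c₁)) (p₂ - c₂))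

/-- The set of objective values over feasible triples. -/
def ObjValues (c₁ c₂ l₁ l₂ p₁ p₂ q₀ χ : ℝ) : Set ℝ :=
  {e | ∃ β γ k : ℝ, Feasible q₀ χ β γ k ∧ e = Obj c₁ c₂ l₁ l₂ p₁ p₂ β γ k}

end
/-- The cutoff posterior of a price list is at most one. -/
theorem qBar_le_one {c₁ c₂ l₁ l₂ p₁ p₂ : ℝ} (hc₁ : 0 ≤ c₁) (hl : l₁ < l₂) (hl₂ : 0 < l₂)
    (hp : IsPriceList c₁ c₂ l₁ l₂ p₁ p₂) : qBar l₁ l₂ p₁ p₂ ≤ 1 := by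
  obtain ⟨hp₁, -, -, hp₂, -⟩ := hp
  unfold qBar
  split_ifs
  · rw [div_le_one (by linarith)]
    linarith
  · rw [div_le_one hl₂]
    linarith

/-- sufficiency claim in the proof of Proposition 1: when χ ≥ χ̲(q₀; p), the
triple (0, q̄(p), 1 − q₀/q̄(p)) is feasible and its objective value equals
λ(p)·q₀ + (p₁ − c₁) > p₁ − c₁. -/
theorem lrs_sufficiency
    (c₁ c₂ l₁ l₂ : ℝ) (hc₁ : 0 ≤ c₁) (hc : c₁ < c₂) (h₁ : c₁ < l₁) (h₂ : c₂ < l₂)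
    (hs : l₁ - c₁ < l₂ - c₂)
    (p₁ p₂ : ℝ) (hp : IsPriceList c₁ c₂ l₁ l₂ p₁ p₂) (hP2 : p₁ - c₁ < p₂ - c₂)
    (q₀ χ : ℝ) (hq₀ : 0 < q₀) (hq₀' : q₀ < qBar l₁ l₂ p₁ p₂)
    (hχ : χ ∈ Set.Ioo (0:ℝ) 1) (hχge : chiLo l₁ l₂ p₁ p₂ q₀ ≤ χ) :
    Feasible q₀ χ 0 (qBar l₁ l₂ p₁ p₂) (1 - q₀ / qBar l₁ l₂ p₁ p₂) ∧
    Obj c₁ c₂ l₁ l₂ p₁ p₂ 0 (qBar l₁ l₂ p₁ p₂) (1 - q₀ / qBar l₁ l₂ p₁ p₂)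
      = lamP c₁ c₂ l₁ l₂ p₁ p₂ * q₀ + (p₁ - c₁) ∧
    p₁ - c₁ < lamP c₁ c₂ l₁ l₂ p₁ p₂ * q₀ + (p₁ - c₁) := by
  have hq1 := qBar_le_one hc₁ (by linarith) (by linarith) hp
  unfold Feasible Obj
  unfold lamP
  unfold chiLo at hχge
  set q := qBar l₁ l₂ p₁ p₂
  have hq : 0 < q := hq₀.trans hq₀'
  have hk0 : 0 ≤ q₀ / q := by positivity
  have hk1 : q₀ / q ≤ 1 := (div_le_one hq).2 hq₀'.le
  have hk : 1 - q₀ / q ≤ χ * (1 - q₀) := by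
    have hq₀1 : 0 < 1 - q₀ := by linarith
    rw [div_le_iff₀ (mul_pos hq hq₀1)] at hχge
    rw [one_sub_div hq.ne', div_le_iff₀ hq]
    linarith
  refine ⟨⟨⟨le_rfl, zero_le_one⟩, ⟨hq.le, hq1⟩, ⟨by linarith, by linarith⟩, ?_, ?_, ?_⟩, ?_, ?_⟩
  · field_simp
    ring
  · simpa using mul_nonneg hχ.1.le hq₀.le
  · simpa using hk
  · simp only [lt_irrefl, if_false, mul_zero, zero_add, min_eq_left hP2.le]
    field_simp
    ring
  · have : 0 < (p₂ - c₂ - (p₁ - c₁)) / q * q₀ := mul_pos (div_pos (by linarith) hq) hq₀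
    linarith
end

section
/- (Necessity claim in the proof of Proposition 1.) Let p ∈ P², q₀ ∈ (0, q̄(p)) and χ ∈ (0,1). If some feasible triple has objective value strictly greater than p₁ − c₁, then χ ≥ χ̲(q₀; p), and moreover every feasible triple has objective value at most λ(p)·q₀ + (p₁ − c₁). -/
open Set Filter
open scoped Classical

/-- The cutoff posterior of a price list is at most one. -/
lemma qBar_le_one_s5 {l₁ l₂ p₁ p₂ : ℝ} (hl₁ : 0 ≤ l₁) (hl : l₁ < l₂) (hp₁ : 0 ≤ p₁)
    (hp₂ : p₂ ≤ l₂) : qBar l₁ l₂ p₁ p₂ ≤ 1 := by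
  unfold qBar
  split_ifs
  · rw [div_le_one (by linarith)]
    linarith
  · rw [div_le_one (by linarith)]
    linarith

/-- If the good posterior `γ` lies below the cutoff, the objective is the low margin. -/
lemma obj_of_lt {c₁ c₂ l₁ l₂ p₁ p₂ β γ k : ℝ} (h : γ < qBar l₁ l₂ p₁ p₂) :
    Obj c₁ c₂ l₁ l₂ p₁ p₂ β γ k = p₁ - c₁ := by
  simp only [Obj, if_pos h]
  ring

/-- A feasible triple with `γ` above the cutoff forces `χ` above the credibility threshold. -/
lemma chiLo_le_of_feasible {l₁ l₂ p₁ p₂ q₀ χ β γ k : ℝ} (hQ : 0 < qBar l₁ l₂ p₁ p₂)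
    (hQ1 : qBar l₁ l₂ p₁ p₂ ≤ 1) (hq : q₀ < 1) (hf : Feasible q₀ χ β γ k)
    (hγ : qBar l₁ l₂ p₁ p₂ ≤ γ) : chiLo l₁ l₂ p₁ p₂ q₀ ≤ χ := by
  obtain ⟨⟨hβ0, -⟩, -, ⟨hk0, hk1⟩, hsum, -, hbad⟩ := hf
  unfold chiLo
  generalize qBar l₁ l₂ p₁ p₂ = Q at *
  rw [div_le_iff₀ (mul_pos hQ (by linarith))]
  have hmass : (1 - χ) * (1 - q₀) ≤ (1 - k) * (1 - γ) := by linarith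
  have hkβ := mul_nonneg hk0 hβ0
  have hcut := mul_le_mul_of_nonneg_left hγ (sub_nonneg.2 hk1)
  have hprior := mul_le_mul_of_nonneg_right
    (show (1 - k) * γ ≤ q₀ by linarith) (sub_nonneg.2 hQ1)
  have hscaled := mul_le_mul_of_nonneg_left hmass hQ.le
  linarith

/-- Every feasible triple has objective at most the linear value `λ(p) q₀ + (p₁ - c₁)`. -/
lemma obj_le_of_feasible {c₁ c₂ l₁ l₂ p₁ p₂ q₀ χ β γ k : ℝ} (hP2 : p₁ - c₁ < p₂ - c₂)
    (hQ : 0 < qBar l₁ l₂ p₁ p₂) (hq : 0 ≤ q₀) (hf : Feasible q₀ χ β γ k) :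
    Obj c₁ c₂ l₁ l₂ p₁ p₂ β γ k ≤ lamP c₁ c₂ l₁ l₂ p₁ p₂ * q₀ + (p₁ - c₁) := by
  obtain ⟨-, -, ⟨hk0, hk1⟩, rfl, -, -⟩ := hf
  have hlam : 0 ≤ lamP c₁ c₂ l₁ l₂ p₁ p₂ := div_nonneg (by linarith) hQ.le
  have hlamQ : lamP c₁ c₂ l₁ l₂ p₁ p₂ * qBar l₁ l₂ p₁ p₂ = (p₂ - c₂) - (p₁ - c₁) :=
    div_mul_cancel₀ _ hQ.ne'
  rcases lt_or_ge γ (qBar l₁ l₂ p₁ p₂) with h | h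
  · rw [obj_of_lt h]
    linarith [mul_nonneg hlam hq]
  · simp only [Obj, if_neg h.not_gt]
    have hmin := mul_le_mul_of_nonneg_left
      (min_le_left (lamP c₁ c₂ l₁ l₂ p₁ p₂ * β + (p₁ - c₁)) (p₂ - c₂)) hk0
    have hgood := mul_le_mul_of_nonneg_left
      (show p₂ - c₂ ≤ lamP c₁ c₂ l₁ l₂ p₁ p₂ * γ + (p₁ - c₁) by
        linarith [mul_le_mul_of_nonneg_left h hlam]) (sub_nonneg.2 hk1)
    linarith

/-- necessity claim in the proof of Proposition 1: if some feasible triple has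
objective value strictly above p₁ − c₁, then χ ≥ χ̲(q₀; p) and every feasible triple has
objective value at most λ(p)·q₀ + (p₁ − c₁). -/
theorem lrs_necessity
    (c₁ c₂ l₁ l₂ : ℝ) (hc₁ : 0 ≤ c₁) (hc : c₁ < c₂) (h₁ : c₁ < l₁) (h₂ : c₂ < l₂)
    (hs : l₁ - c₁ < l₂ - c₂)
    (p₁ p₂ : ℝ) (hp : IsPriceList c₁ c₂ l₁ l₂ p₁ p₂) (hP2 : p₁ - c₁ < p₂ - c₂)
    (q₀ χ : ℝ) (hq₀ : 0 < q₀) (hq₀' : q₀ < qBar l₁ l₂ p₁ p₂)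
    (hχ : χ ∈ Set.Ioo (0:ℝ) 1)
    (hex : ∃ β γ k : ℝ, Feasible q₀ χ β γ k ∧
      p₁ - c₁ < Obj c₁ c₂ l₁ l₂ p₁ p₂ β γ k) :
    chiLo l₁ l₂ p₁ p₂ q₀ ≤ χ ∧
    ∀ β γ k : ℝ, Feasible q₀ χ β γ k →
      Obj c₁ c₂ l₁ l₂ p₁ p₂ β γ k ≤ lamP c₁ c₂ l₁ l₂ p₁ p₂ * q₀ + (p₁ - c₁) := by
  obtain ⟨hp₁, -, -, hp₂, -⟩ := hp
  have hQ : 0 < qBar l₁ l₂ p₁ p₂ := hq₀.trans hq₀'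
  have hQ1 : qBar l₁ l₂ p₁ p₂ ≤ 1 :=
    qBar_le_one_s5 (by linarith) (by linarith) (by linarith) hp₂
  refine ⟨?_, fun β γ k hf => obj_le_of_feasible hP2 hQ hq₀.le hf⟩
  obtain ⟨β, γ, k, hf, hobj⟩ := hex
  exact chiLo_le_of_feasible hQ hQ1 (hq₀'.trans_le hQ1) hf
    (not_lt.1 fun h => hobj.ne' (obj_of_lt h))
end
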